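/- arXiv:1003.2825 — 2 statements merged into one kernel-verified Lean document; each statement's English description precedes it below -/
import Mathlib

section
/- Order the seven variables as x₁ = t₄, x₂ = t₁, x₃ = t₂, x₄ = t₃, x₅ = t₁₂, x₆ = t₁₃, x₇ = t₂₃ and work in ℝ[x₁,…,x₇]. Define c₀ := 4 − t₁² − t₂² − t₃² − t₄² − t₁t₂t₃t₄, kₛ := t₁₃t₂ + t₁t₂₃ + t₁₂t₃ − t₁t₂t₃, k_p := t₁² + t₂² + t₃² + t₁₂² + t₁₃² + t₂₃² + t₁₂t₁₃t₂₃ − t₂t₃t₂₃ − t₁t₂t₁₂ − t₁t₃t₁₃ − 4, k := k_p − t₄(kₛ − t₄), p₁₂ := −2 + t₁² + t₁₂² − t₁t₁₂t₂ + t₂², p₂₃ := −2 + t₂² + t₂₃² − t₂t₂₃t₃ + t₃², p₁₃ := −2 + t₁² + t₁₃² − t₁t₁₃t₃ + t₃², p₀ := c₀ + t₁t₁₂t₂ + t₄t₁₃t₂ + t₁t₄t₂₃ + t₁₂t₄t₃ − t₁t₁₃t₃ − t₁t₁₂t₂₃t₃ + t₂t₂₃t₃ + t₁²t₃² − 2.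 Let s be the determinant of the 7×7 matrix whose rows are the formal gradients (∂/∂x₁, …, ∂/∂x₇) of the seven polynomials t₄, kₛ − t₄, k, p₁₂, p₂₃, p₁₃, p₀ (in that order). Let W be the 7×7 skew-symmetric matrix over ℝ[x₁,…,x₇] with W₂₃ = −2t₁₂ + t₁t₂, W₂₄ = 2t₁₃ − t₁t₃, W₂₅ = −t₁t₁₂ + 2t₂, W₂₆ = t₁t₁₃ − 2t₃, W₃₄ = −2t₂₃ + t₂t₃, W₃₅ = −2t₁ + t₁₂t₂, W₃₇ = −t₂t₂₃ + 2t₃, W₄₆ = 2t₁ − t₁₃t₃, W₄₇ = −2t₂ + t₂₃t₃, W₅₆ = −t₁₂t₁₃ − 2t₂₃ + 2t₂t₃, W₅₇ = 2t₁₃ + t₁₂t₂₃ − 2t₁t₃, W₆₇ = −2t₁₂ + 2t₁t₂ − t₁₃t₂₃, all other entries on or above the diagonal equal to 0, and Wⱼᵢ = −Wᵢⱼ. Define H₁₂(s) := Σᵢ (Σⱼ Wᵢⱼ·∂p₁₂/∂xⱼ)·∂s/∂xᵢ. Then H₁₂(s) does not belong to the ideal of ℝ[x₁,…,x₇] generated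 by k and s. -/
namespace TorusStmt11

open MvPolynomial

/-- The seven trace variables, ordered as `x₁ = t₄, x₂ = t₁, x₃ = t₂, x₄ = t₃,
x₅ = t₁₂, x₆ = t₁₃, x₇ = t₂₃`. -/
noncomputable def t₄ : MvPolynomial (Fin 7) ℝ := X 0
noncomputable def t₁ : MvPolynomial (Fin 7) ℝ := X 1
noncomputable def t₂ : MvPolynomial (Fin 7) ℝ := X 2
noncomputable def t₃ : MvPolynomial (Fin 7) ℝ := X 3
noncomputable def t₁₂ : MvPolynomial (Fin 7) ℝ := X 4
noncomputable def t₁₃ : MvPolynomial (Fin 7) ℝ := X 5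
noncomputable def t₂₃ : MvPolynomial (Fin 7) ℝ := X 6

noncomputable def c₀ : MvPolynomial (Fin 7) ℝ :=
  4 - t₁ ^ 2 - t₂ ^ 2 - t₃ ^ 2 - t₄ ^ 2 - t₁ * t₂ * t₃ * t₄

/-- The sum polynomial `kₛ`. -/
noncomputable def ks : MvPolynomial (Fin 7) ℝ :=
  t₁₃ * t₂ + t₁ * t₂₃ + t₁₂ * t₃ - t₁ * t₂ * t₃

/-- The product polynomial `k_p`. -/
noncomputable def kp : MvPolynomial (Fin 7) ℝ :=
  t₁ ^ 2 + t₂ ^ 2 + t₃ ^ 2 + t₁₂ ^ 2 + t₁₃ ^ 2 + t₂₃ ^ 2 + t₁₂ * t₁₃ * t₂₃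
    - t₂ * t₃ * t₂₃ - t₁ * t₂ * t₁₂ - t₁ * t₃ * t₁₃ - 4

/-- The defining polynomial `k = k_p − t₄(kₛ − t₄)` of `𝔛`. -/
noncomputable def k : MvPolynomial (Fin 7) ℝ := kp - t₄ * (ks - t₄)

/-- The trace polynomials of the separating curves `FᵢFⱼFᵢ⁻¹Fⱼ⁻¹` and `F₀`. -/
noncomputable def p₁₂ : MvPolynomial (Fin 7) ℝ :=
  -2 + t₁ ^ 2 + t₁₂ ^ 2 - t₁ * t₁₂ * t₂ + t₂ ^ 2
noncomputable def p₂₃ : MvPolynomial (Fin 7) ℝ :=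
  -2 + t₂ ^ 2 + t₂₃ ^ 2 - t₂ * t₂₃ * t₃ + t₃ ^ 2
noncomputable def p₁₃ : MvPolynomial (Fin 7) ℝ :=
  -2 + t₁ ^ 2 + t₁₃ ^ 2 - t₁ * t₁₃ * t₃ + t₃ ^ 2
noncomputable def p₀ : MvPolynomial (Fin 7) ℝ :=
  c₀ + t₁ * t₁₂ * t₂ + t₄ * t₁₃ * t₂ + t₁ * t₄ * t₂₃
    + t₁₂ * t₄ * t₃ - t₁ * t₁₃ * t₃ - t₁ * t₁₂ * t₂₃ * t₃ + t₂ * t₂₃ * t₃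
    + t₁ ^ 2 * t₃ ^ 2 - 2

/-- The seven polynomials `t₄, kₛ − t₄, k, p₁₂, p₂₃, p₁₃, p₀` (in that order). -/
noncomputable def f : Fin 7 → MvPolynomial (Fin 7) ℝ :=
  ![t₄, ks - t₄, k, p₁₂, p₂₃, p₁₃, p₀]

/-- `s` is the determinant of the `7 × 7` matrix whose rows are the formal
gradients of `t₄, kₛ − t₄, k, p₁₂, p₂₃, p₁₃, p₀`. -/
noncomputable def s : MvPolynomial (Fin 7) ℝ :=
  Matrix.det (Matrix.of fun i j : Fin 7 => pderiv j (f i))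

/-- The strictly-upper-triangular part of the symplectic bi-vector `W`. -/
noncomputable def Wup : Matrix (Fin 7) (Fin 7) (MvPolynomial (Fin 7) ℝ) :=
  Matrix.of fun i j : Fin 7 =>
    if i = 1 ∧ j = 2 then -2 * t₁₂ + t₁ * t₂
    else if i = 1 ∧ j = 3 then 2 * t₁₃ - t₁ * t₃
    else if i = 1 ∧ j = 4 then -t₁ * t₁₂ + 2 * t₂
    else if i = 1 ∧ j = 5 then t₁ * t₁₃ - 2 * t₃
    else if i = 2 ∧ j = 3 then -2 * t₂₃ + t₂ * t₃
    else if i = 2 ∧ j = 4 then -2 * t₁ + t₁₂ * t₂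
    else if i = 2 ∧ j = 6 then -t₂ * t₂₃ + 2 * t₃
    else if i = 3 ∧ j = 5 then 2 * t₁ - t₁₃ * t₃
    else if i = 3 ∧ j = 6 then -2 * t₂ + t₂₃ * t₃
    else if i = 4 ∧ j = 5 then -t₁₂ * t₁₃ - 2 * t₂₃ + 2 * t₂ * t₃
    else if i = 4 ∧ j = 6 then 2 * t₁₃ + t₁₂ * t₂₃ - 2 * t₁ * t₃
    else if i = 5 ∧ j = 6 then -2 * t₁₂ + 2 * t₁ * t₂ - t₁₃ * t₂₃
    else 0

/-- The skew-symmetric symplectic bi-vector matrix `W = Wup − Wupᵀ`. -/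
noncomputable def W : Matrix (Fin 7) (Fin 7) (MvPolynomial (Fin 7) ℝ) :=
  Wup - Wup.transpose

/-- `H₁₂(s) = Σᵢ (Σⱼ Wᵢⱼ ∂p₁₂/∂xⱼ) ∂s/∂xᵢ`, the derivative of `s` along the
Hamiltonian vector field of `p₁₂`. -/
noncomputable def H₁₂s : MvPolynomial (Fin 7) ℝ :=
  ∑ i : Fin 7, (∑ j : Fin 7, W i j * pderiv j p₁₂) * pderiv i s

/-- The chain rule for substituting univariate polynomials into a multivariate one. -/
theorem derivative_aeval_eq_sum {σ R : Type*} [Fintype σ] [CommRing R]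
    (g : σ → Polynomial R) (p : MvPolynomial σ R) :
    Polynomial.derivative (aeval g p) =
      ∑ i, aeval g (pderiv i p) * Polynomial.derivative (g i) := by
  classical
  induction p using MvPolynomial.induction_on with
  | C a => simp
  | add p q hp hq => simp [hp, hq, add_mul, Finset.sum_add_distrib]
  | mul_X p j hp =>
    have h (i : σ) : aeval g (pderiv i (p * X j)) =
        aeval g p * (if i = j then 1 else 0) + g j * aeval g (pderiv i p) := by
      rw [pderiv_mul, pderiv_X, map_add, map_mul, map_mul, aeval_X, add_comm, Pi.single_apply]
      simp only [apply_ite (aeval g), map_one, map_zero, mul_comm, eq_comm]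
    rw [map_mul, aeval_X, Polynomial.derivative_mul, hp]
    simp only [h, add_mul, Finset.sum_add_distrib, Finset.sum_mul, mul_assoc, ite_mul, one_mul,
      zero_mul, mul_ite, mul_zero, Finset.sum_ite_eq', Finset.mem_univ, if_true]
    rw [add_comm]
    congr 1
    exact Finset.sum_congr rfl fun i _ => by ring

theorem pderiv_ofNat {σ R : Type*} [CommSemiring R] (i : σ) (n : ℕ) [n.AtLeastTwo] :
    pderiv i (ofNat(n) : MvPolynomial σ R) = 0 :=
  Derivation.map_natCast _ n

/-- A line in `ℝ⁷` whose direction is proportional to `W(dp₁₂)` at the parameter `0`. -/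
noncomputable def line : Fin 7 → Polynomial ℝ :=
  ![1, 0, 1, Polynomial.X, 1, Polynomial.X, 1]

theorem det_jacobian_line {R : Type*} [CommRing R] (x : R) :
    Matrix.det !![1, 0, 0, 0, 0, 0, 0;
      -1, 1 - x, x, 1, x, 1, 0;
      2 - 2 * x, x - 2 - x ^ 2, 2 - 2 * x, 2 * x - 2, 2, 2 * x, 2;
      0, -1, 2, 0, 2, 0, 0;
      0, 0, 2 - x, 2 * x - 1, 0, 0, 2 - x;
      0, -x ^ 2, 0, 2 * x, 0, 2 * x, 0;
      2 * x - 2, 2 - 2 * x - x ^ 2, 2 * x - 2, 2 - 2 * x, x, 1, x] = 32 * x ^ 3 - 32 * x := by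
  simp [Matrix.det_succ_row_zero, Fin.sum_univ_succ, Fin.succAbove]
  ring

theorem aeval_line_s :
    aeval line s = 32 * Polynomial.X ^ 3 - 32 * Polynomial.X := by
  rw [← det_jacobian_line, s, AlgHom.map_det]
  congr 1
  ext1 i j
  fin_cases i <;> fin_cases j <;>
    simp [f, k, kp, ks, p₁₂, p₂₃, p₁₃, p₀, c₀, t₄, t₁, t₂, t₃, t₁₂, t₁₃, t₂₃, line,
      pderiv_X, pderiv_ofNat, Derivation.leibniz_pow] <;>
    ring

/-- The base point of `line`. -/
noncomputable def basePoint : Fin 7 → ℝ := ![1, 0, 1, 0, 1, 0, 1]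

theorem eval_zero_aeval_line (p : MvPolynomial (Fin 7) ℝ) :
    (aeval line p).eval 0 = eval basePoint p := by
  induction p using MvPolynomial.induction_on with
  | C a => simp
  | add p q hp hq => simp [hp, hq]
  | mul_X p j hp =>
    simp only [map_mul, aeval_X, eval_X, Polynomial.eval_mul, hp]
    congr 1
    fin_cases j <;> simp [line, basePoint]

theorem eval_basePoint_k : eval basePoint k = 0 := by
  simp [k, kp, ks, t₄, t₁, t₂, t₃, t₁₂, t₁₃, t₂₃, basePoint]
  norm_num

theorem eval_basePoint_s : eval basePoint s = 0 := by
  simp [← eval_zero_aeval_line, aeval_line_s]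

theorem eval_basePoint_pderiv_s :
    eval basePoint (pderiv 3 s) + eval basePoint (pderiv 5 s) = -32 := by
  have h := congrArg (Polynomial.eval 0) (derivative_aeval_eq_sum line s)
  simp only [aeval_line_s, Polynomial.eval_finsetSum, Polynomial.eval_mul,
    eval_zero_aeval_line] at h
  simpa [Fin.sum_univ_succ, line] using h.symm

theorem eval_basePoint_hamiltonian (i : Fin 7) :
    eval basePoint (∑ j, W i j * pderiv j p₁₂) = ![0, 0, 0, 4, 0, 4, 0] i := by
  fin_cases i <;>
    simp [Fin.sum_univ_succ, W, Wup, p₁₂, t₁, t₂, t₃, t₁₂, t₁₃, t₂₃, basePoint,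
      pderiv_X, pderiv_ofNat, Pi.single_apply, Derivation.leibniz_pow] <;>
    norm_num

theorem eval_basePoint_H₁₂s : eval basePoint H₁₂s = -128 := by
  have h : eval basePoint H₁₂s =
      ∑ i, (![0, 0, 0, 4, 0, 4, 0] : Fin 7 → ℝ) i * eval basePoint (pderiv i s) := by
    rw [H₁₂s, map_sum]
    exact Finset.sum_congr rfl fun i _ => by rw [map_mul, eval_basePoint_hamiltonian]
  simp only [Fin.sum_univ_seven, Matrix.cons_val] at h
  linear_combination h + 4 * eval_basePoint_pderiv_s

/-- Lemma 3.8 (key computation for the 2-holed torus): `H₁₂(s)` is not in the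
ideal `(k, s)`. -/
theorem H₁₂s_not_mem_ideal :
    H₁₂s ∉ Ideal.span ({k, s} : Set (MvPolynomial (Fin 7) ℝ)) := by
  intro h
  obtain ⟨a, b, hab⟩ := Ideal.mem_span_pair.mp h
  have := congrArg (eval basePoint) hab
  norm_num [eval_basePoint_k, eval_basePoint_s, eval_basePoint_H₁₂s] at this

end TorusStmt11
end

section
/- Order the seven variables as x₁ = t₄, x₂ = t₁, x₃ = t₂, x₄ = t₃, x₅ = t₁₂, x₆ = t₁₃, x₇ = t₂₃ and work in ℝ[x₁,…,x₇]. Define c₀ := 4 − t₁² − t₂² − t₃² − t₄² − t₁t₂t₃t₄, kₛ := t₁₃t₂ + t₁t₂₃ + t₁₂t₃ − t₁t₂t₃, k_p := t₁² + t₂² + t₃² + t₁₂² + t₁₃² + t₂₃² + t₁₂t₁₃t₂₃ − t₂t₃t₂₃ − t₁t₂t₁₂ − t₁t₃t₁₃ − 4, k := k_p − t₄(kₛ − t₄), p₁₂ := −2 + t₁² + t₁₂² − t₁t₁₂t₂ + t₂², p₂₃ := −2 + t₂² + t₂₃² − t₂t₂₃t₃ + t₃², p₁₃ := −2 + t₁²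 + t₁₃² − t₁t₁₃t₃ + t₃², p₀ := c₀ + t₁t₁₂t₂ + t₄t₁₃t₂ + t₁t₄t₂₃ + t₁₂t₄t₃ − t₁t₁₃t₃ − t₁t₁₂t₂₃t₃ + t₂t₂₃t₃ + t₁²t₃² − 2. Let s be the determinant of the 7×7 matrix whose rows are the formal gradients of t₄, kₛ − t₄, k, p₁₂, p₂₃, p₁₃, p₀ (in that order) with respect to (x₁, …, x₇). Then s is reducible: there exist polynomials s₁, s₂ ∈ ℝ[x₁,…,x₇], neither of which is a unit, with s = s₁·s₂. -/
namespace TorusStmt12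

open MvPolynomial

/-- The seven trace variables, ordered as `x₁ = t₄, x₂ = t₁, x₃ = t₂, x₄ = t₃,
x₅ = t₁₂, x₆ = t₁₃, x₇ = t₂₃`. -/
noncomputable def t₄ : MvPolynomial (Fin 7) ℝ := X 0
noncomputable def t₁ : MvPolynomial (Fin 7) ℝ := X 1
noncomputable def t₂ : MvPolynomial (Fin 7) ℝ := X 2
noncomputable def t₃ : MvPolynomial (Fin 7) ℝ := X 3
noncomputable def t₁₂ : MvPolynomial (Fin 7) ℝ := X 4
noncomputable def t₁₃ : MvPolynomial (Fin 7) ℝ := X 5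
noncomputable def t₂₃ : MvPolynomial (Fin 7) ℝ := X 6

noncomputable def c₀ : MvPolynomial (Fin 7) ℝ :=
  4 - t₁ ^ 2 - t₂ ^ 2 - t₃ ^ 2 - t₄ ^ 2 - t₁ * t₂ * t₃ * t₄

/-- The sum polynomial `kₛ`. -/
noncomputable def ks : MvPolynomial (Fin 7) ℝ :=
  t₁₃ * t₂ + t₁ * t₂₃ + t₁₂ * t₃ - t₁ * t₂ * t₃

/-- The product polynomial `k_p`. -/
noncomputable def kp : MvPolynomial (Fin 7) ℝ :=
  t₁ ^ 2 + t₂ ^ 2 + t₃ ^ 2 + t₁₂ ^ 2 + t₁₃ ^ 2 + t₂₃ ^ 2 + t₁₂ * t₁₃ * t₂₃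
    - t₂ * t₃ * t₂₃ - t₁ * t₂ * t₁₂ - t₁ * t₃ * t₁₃ - 4

/-- The defining polynomial `k = k_p − t₄(kₛ − t₄)` of `𝔛`. -/
noncomputable def k : MvPolynomial (Fin 7) ℝ := kp - t₄ * (ks - t₄)

/-- The trace polynomials of the separating curves `FᵢFⱼFᵢ⁻¹Fⱼ⁻¹` and `F₀`. -/
noncomputable def p₁₂ : MvPolynomial (Fin 7) ℝ :=
  -2 + t₁ ^ 2 + t₁₂ ^ 2 - t₁ * t₁₂ * t₂ + t₂ ^ 2
noncomputable def p₂₃ : MvPolynomial (Fin 7) ℝ :=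
  -2 + t₂ ^ 2 + t₂₃ ^ 2 - t₂ * t₂₃ * t₃ + t₃ ^ 2
noncomputable def p₁₃ : MvPolynomial (Fin 7) ℝ :=
  -2 + t₁ ^ 2 + t₁₃ ^ 2 - t₁ * t₁₃ * t₃ + t₃ ^ 2
noncomputable def p₀ : MvPolynomial (Fin 7) ℝ :=
  c₀ + t₁ * t₁₂ * t₂ + t₄ * t₁₃ * t₂ + t₁ * t₄ * t₂₃
    + t₁₂ * t₄ * t₃ - t₁ * t₁₃ * t₃ - t₁ * t₁₂ * t₂₃ * t₃ + t₂ * t₂₃ * t₃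
    + t₁ ^ 2 * t₃ ^ 2 - 2

/-- The seven polynomials `t₄, kₛ − t₄, k, p₁₂, p₂₃, p₁₃, p₀` (in that order). -/
noncomputable def f : Fin 7 → MvPolynomial (Fin 7) ℝ :=
  ![t₄, ks - t₄, k, p₁₂, p₂₃, p₁₃, p₀]

/-- `s` is the determinant of the `7 × 7` matrix whose rows are the formal
gradients of `t₄, kₛ − t₄, k, p₁₂, p₂₃, p₁₃, p₀`. -/
noncomputable def s : MvPolynomial (Fin 7) ℝ :=
  Matrix.det (Matrix.of fun i j : Fin 7 => pderiv j (f i))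


/-- The factor of `s` of total degree five. -/
noncomputable def quinticFactor : MvPolynomial (Fin 7) ℝ :=
  t₁ ^ 3 * t₂ * t₃ - t₁ ^ 2 * t₂ * t₁₂ * t₂₃ - t₁ ^ 2 * t₂ * t₁₃ - t₁ ^ 2 * t₃ * t₁₂
    - t₁ ^ 2 * t₃ * t₁₃ * t₂₃ + t₁ * t₂ ^ 2 * t₂₃ - t₁ * t₂ * t₃ ^ 3 + t₁ * t₃ ^ 2 * t₁₂ * t₁₃
    + t₁ * t₃ ^ 2 * t₂₃ + t₁ * t₁₂ ^ 2 * t₂₃ + t₁ * t₁₂ * t₁₃ * t₂₃ ^ 2 + t₁ * t₁₃ ^ 2 * t₂₃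
    - t₂ ^ 2 * t₃ * t₁₂ + t₂ * t₃ ^ 2 * t₁₂ * t₂₃ + t₂ * t₃ ^ 2 * t₁₃ + t₂ * t₁₂ ^ 2 * t₁₃
    - t₂ * t₁₃ * t₂₃ ^ 2 - t₃ * t₁₂ ^ 2 * t₁₃ * t₂₃ - t₃ * t₁₂ * t₁₃ ^ 2 - t₃ * t₁₂ * t₂₃ ^ 2

/-- The cofactor of `quinticFactor` in `s`, up to a numerical multiple. -/
noncomputable def septicFactor : MvPolynomial (Fin 7) ℝ :=
  t₁ ^ 3 * t₂ * t₃ ^ 3 - 2 * t₁ ^ 3 * t₂ * t₃ - t₁ ^ 3 * t₃ ^ 2 * t₂₃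
    + t₁ ^ 2 * t₂ ^ 2 * t₃ * t₁₂ - t₁ ^ 2 * t₂ * t₃ ^ 2 * t₁₂ * t₂₃
    - 2 * t₁ ^ 2 * t₂ * t₃ ^ 2 * t₁₃ + t₁ ^ 2 * t₂ * t₁₂ * t₂₃ + 2 * t₁ ^ 2 * t₂ * t₁₃
    - t₁ ^ 2 * t₃ ^ 3 * t₁₂ + t₁ ^ 2 * t₃ * t₁₂ * t₂₃ ^ 2 + 2 * t₁ ^ 2 * t₃ * t₁₂
    + 3 * t₁ ^ 2 * t₃ * t₁₃ * t₂₃ + t₁ * t₂ ^ 2 * t₃ ^ 2 * t₂₃ - t₁ * t₂ ^ 2 * t₁₂ * t₁₃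
    - 2 * t₁ * t₂ ^ 2 * t₂₃ - 2 * t₁ * t₂ * t₃ ^ 3 - t₁ * t₂ * t₃ * t₁₂ ^ 2
    + t₁ * t₂ * t₃ * t₁₃ ^ 2 - t₁ * t₂ * t₃ * t₂₃ ^ 2 + 4 * t₁ * t₂ * t₃
    + t₁ * t₃ ^ 2 * t₁₂ ^ 2 * t₂₃ + 3 * t₁ * t₃ ^ 2 * t₁₂ * t₁₃ + 2 * t₁ * t₃ ^ 2 * t₂₃
    - 2 * t₁ * t₁₂ ^ 2 * t₂₃ - t₁ * t₁₂ * t₁₃ * t₂₃ ^ 2 - 4 * t₁ * t₁₂ * t₁₃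
    - 2 * t₁ * t₁₃ ^ 2 * t₂₃ - 2 * t₂ ^ 2 * t₃ * t₁₂ - t₂ ^ 2 * t₃ * t₁₃ * t₂₃
    + t₂ * t₃ ^ 2 * t₁₂ * t₂₃ + 2 * t₂ * t₃ ^ 2 * t₁₃ + 2 * t₂ * t₁₂ ^ 2 * t₁₃
    + t₂ * t₁₂ * t₁₃ ^ 2 * t₂₃ + 4 * t₂ * t₁₂ * t₂₃ + 2 * t₂ * t₁₃ * t₂₃ ^ 2
    - t₃ * t₁₂ ^ 2 * t₁₃ * t₂₃ - 2 * t₃ * t₁₂ * t₁₃ ^ 2 - 2 * t₃ * t₁₂ * t₂₃ ^ 2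
    - 4 * t₃ * t₁₃ * t₂₃

/-- Numerals have zero partial derivatives. -/
theorem pderiv_ofNat {σ R : Type*} [CommSemiring R] (i : σ) (n : ℕ) [n.AtLeastTwo] :
    pderiv i (ofNat(n) : MvPolynomial σ R) = 0 := by
  rw [← Nat.cast_ofNat, Derivation.map_natCast]

set_option maxHeartbeats 2000000 in
/-- The Jacobian matrix of `f`, written out. -/
theorem jacobian_f_eq : (Matrix.of fun i j : Fin 7 => pderiv j (f i)) =
    !![
    1, 0, 0, 0, 0, 0, 0;
    -1, -t₂ * t₃ + t₂₃, -t₁ * t₃ + t₁₃, -t₁ * t₂ + t₁₂, t₃, t₂, t₁;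
    2 * t₄ + t₁ * t₂ * t₃ - t₁ * t₂₃ - t₂ * t₁₃ - t₃ * t₁₂,
      t₄ * t₂ * t₃ - t₄ * t₂₃ + 2 * t₁ - t₂ * t₁₂ - t₃ * t₁₃,
      t₄ * t₁ * t₃ - t₄ * t₁₃ - t₁ * t₁₂ + 2 * t₂ - t₃ * t₂₃,
      t₄ * t₁ * t₂ - t₄ * t₁₂ - t₁ * t₁₃ - t₂ * t₂₃ + 2 * t₃,
      -t₄ * t₃ - t₁ * t₂ + 2 * t₁₂ + t₁₃ * t₂₃, -t₄ * t₂ - t₁ * t₃ + t₁₂ * t₂₃ + 2 * t₁₃,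
      -t₄ * t₁ - t₂ * t₃ + t₁₂ * t₁₃ + 2 * t₂₃;
    0, 2 * t₁ - t₂ * t₁₂, -t₁ * t₁₂ + 2 * t₂, 0, -t₁ * t₂ + 2 * t₁₂, 0, 0;
    0, 0, 2 * t₂ - t₃ * t₂₃, -t₂ * t₂₃ + 2 * t₃, 0, 0, -t₂ * t₃ + 2 * t₂₃;
    0, 2 * t₁ - t₃ * t₁₃, 0, -t₁ * t₁₃ + 2 * t₃, 0, -t₁ * t₃ + 2 * t₁₃, 0;
    -2 * t₄ - t₁ * t₂ * t₃ + t₁ * t₂₃ + t₂ * t₁₃ + t₃ * t₁₂,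
      -t₄ * t₂ * t₃ + t₄ * t₂₃ + 2 * t₁ * t₃ ^ 2 - 2 * t₁ + t₂ * t₁₂ - t₃ * t₁₂ * t₂₃ - t₃ * t₁₃,
      -t₄ * t₁ * t₃ + t₄ * t₁₃ + t₁ * t₁₂ - 2 * t₂ + t₃ * t₂₃,
      -t₄ * t₁ * t₂ + t₄ * t₁₂ + 2 * t₁ ^ 2 * t₃ - t₁ * t₁₂ * t₂₃ - t₁ * t₁₃ + t₂ * t₂₃ - 2 * t₃,
      t₄ * t₃ + t₁ * t₂ - t₁ * t₃ * t₂₃, t₄ * t₂ - t₁ * t₃,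
      t₄ * t₁ - t₁ * t₃ * t₁₂ + t₂ * t₃] := by
  ext1 i j
  fin_cases i <;> fin_cases j <;>
    simp [f, k, ks, kp, p₁₂, p₂₃, p₁₃, p₀, c₀, t₄, t₁, t₂, t₃, t₁₂, t₁₃, t₂₃,
      pderiv_X, pderiv_ofNat, Derivation.leibniz_pow] <;>
    ring

/-- The `3 × 3` minor in columns `i, j, l` of the matrix with rows `a, b, c`. -/
def threeRowMinor {R : Type*} [CommRing R] {n : ℕ} (a b c : Fin n → R) (i j l : Fin n) : R :=
  c i * (a j * b l - a l * b j) - c j * (a i * b l - a l * b i) + c l * (a i * b j - a j * b i)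

/-- Laplace expansion of a `7 × 7` determinant with the sparsity pattern of `jacobian_f_eq`. -/
theorem det_sparse_seven {R : Type*} [CommRing R] (a b g : Fin 7 → R)
    (c₁ c₂ c₄ d₂ d₃ d₆ e₁ e₃ e₅ : R) :
    Matrix.det !![1, 0, 0, 0, 0, 0, 0;
      a 0, a 1, a 2, a 3, a 4, a 5, a 6;
      b 0, b 1, b 2, b 3, b 4, b 5, b 6;
      0, c₁, c₂, 0, c₄, 0, 0;
      0, 0, d₂, d₃, 0, 0, d₆;
      0, e₁, 0, e₃, 0, e₅, 0;
      g 0, g 1, g 2, g 3, g 4, g 5, g 6] =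
    let m := threeRowMinor a b g
    c₁ * (d₂ * (e₃ * m 4 5 6 + e₅ * m 3 4 6) - d₃ * e₅ * m 2 4 6
        - d₆ * (e₃ * m 2 4 5 + e₅ * m 2 3 4))
      + c₂ * (d₃ * (e₁ * m 4 5 6 + e₅ * m 1 4 6)
        - d₆ * (e₁ * m 3 4 5 - e₃ * m 1 4 5 - e₅ * m 1 3 4))
      + c₄ * (d₂ * (e₁ * m 3 5 6 - e₃ * m 1 5 6 + e₅ * m 1 3 6)
        - d₃ * (e₁ * m 2 5 6 + e₅ * m 1 2 6)
        - d₆ * (e₁ * m 2 3 5 + e₃ * m 1 2 5 - e₅ * m 1 2 3)) := by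
  rw [Matrix.det_succ_row_zero]
  simp [Fin.sum_univ_succ]
  simp [Matrix.det_succ_row _ 2, Fin.sum_univ_succ, Fin.succAbove]
  simp only [threeRowMinor]
  ring

set_option maxHeartbeats 4000000 in
/-- The factorization of `s` into `quinticFactor` and `septicFactor`. -/
theorem s_eq : s = 4 * quinticFactor * septicFactor := by
  rw [s, jacobian_f_eq]
  refine (det_sparse_seven
    ![-1, -t₂ * t₃ + t₂₃, -t₁ * t₃ + t₁₃, -t₁ * t₂ + t₁₂, t₃, t₂, t₁]
    ![2 * t₄ + t₁ * t₂ * t₃ - t₁ * t₂₃ - t₂ * t₁₃ - t₃ * t₁₂,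
      t₄ * t₂ * t₃ - t₄ * t₂₃ + 2 * t₁ - t₂ * t₁₂ - t₃ * t₁₃,
      t₄ * t₁ * t₃ - t₄ * t₁₃ - t₁ * t₁₂ + 2 * t₂ - t₃ * t₂₃,
      t₄ * t₁ * t₂ - t₄ * t₁₂ - t₁ * t₁₃ - t₂ * t₂₃ + 2 * t₃,
      -t₄ * t₃ - t₁ * t₂ + 2 * t₁₂ + t₁₃ * t₂₃, -t₄ * t₂ - t₁ * t₃ + t₁₂ * t₂₃ + 2 * t₁₃,
      -t₄ * t₁ - t₂ * t₃ + t₁₂ * t₁₃ + 2 * t₂₃]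
    ![-2 * t₄ - t₁ * t₂ * t₃ + t₁ * t₂₃ + t₂ * t₁₃ + t₃ * t₁₂,
      -t₄ * t₂ * t₃ + t₄ * t₂₃ + 2 * t₁ * t₃ ^ 2 - 2 * t₁ + t₂ * t₁₂ - t₃ * t₁₂ * t₂₃ - t₃ * t₁₃,
      -t₄ * t₁ * t₃ + t₄ * t₁₃ + t₁ * t₁₂ - 2 * t₂ + t₃ * t₂₃,
      -t₄ * t₁ * t₂ + t₄ * t₁₂ + 2 * t₁ ^ 2 * t₃ - t₁ * t₁₂ * t₂₃ - t₁ * t₁₃ + t₂ * t₂₃ - 2 * t₃,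
      t₄ * t₃ + t₁ * t₂ - t₁ * t₃ * t₂₃, t₄ * t₂ - t₁ * t₃,
      t₄ * t₁ - t₁ * t₃ * t₁₂ + t₂ * t₃]
    _ _ _ _ _ _ _ _ _).trans ?_
  simp only [threeRowMinor, quinticFactor, septicFactor]
  simp
  ring

/-- A polynomial without constant term is not a unit. -/
theorem not_isUnit_of_constantCoeff_eq_zero {σ R : Type*} [CommSemiring R] [Nontrivial R]
    {p : MvPolynomial σ R} (hp : constantCoeff p = 0) : ¬ IsUnit p := fun h =>
  not_isUnit_zero (hp ▸ h.map constantCoeff)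

/-- The polynomial `s` cutting out the dependency locus for the 2-holed torus is
reducible: it is a product of two non-unit polynomials. -/
theorem s_reducible :
    ∃ s₁ s₂ : MvPolynomial (Fin 7) ℝ, ¬ IsUnit s₁ ∧ ¬ IsUnit s₂ ∧ s = s₁ * s₂ := by
  refine ⟨4 * quinticFactor, septicFactor, not_isUnit_of_constantCoeff_eq_zero ?_,
    not_isUnit_of_constantCoeff_eq_zero ?_, s_eq⟩
  · simp [quinticFactor, t₁, t₂, t₃, t₁₂, t₁₃, t₂₃]
  · simp [septicFactor, t₁, t₂, t₃, t₁₂, t₁₃, t₂₃]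

end TorusStmt12
end
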